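/- arXiv:2505.04760 — 3 statements merged into one kernel-verified Lean document; each statement's English description precedes it below -/
import Mathlib

section
/- Let R be a Prüfer domain and let γ, η ∈ Spec R be points with η the generic point (corresponding to the zero ideal). Let X be an irreducible scheme equipped with a finite type, dominant morphism f : X → Spec R (dominant meaning the image of f is dense). If the fibre X_{κ(γ)} of X over γ is nonempty, then the topological Krull dimension of the fibre X_{κ(η)} equals the topological Krull dimension of the fibre X_{κ(γ)}. -/
open AlgebraicGeometry CategoryTheory CategoryTheory.Limits

universe u

/-- A Prüfer domain: an integral domain whose localisation at every prime ideal is a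
valuation ring.  (Since the localisation of a domain at a prime is again a domain,
being a valuation ring amounts to the divisibility condition recorded by
`PreValuationRing`, i.e. `∀ a b, ∃ c, a * c = b ∨ b * c = a`.) -/
def IsPruferDomain (R : Type*) [CommRing R] : Prop :=
  IsDomain R ∧ ∀ (P : Ideal R) [P.IsPrime], PreValuationRing (Localization.AtPrime P)

namespace PruferAux
open scoped TensorProduct

lemma ringKrullDim_eq_of_isIntegral {A B : Type*} [CommRing A] [CommRing B] [Algebra A B]
    [Algebra.IsIntegral A B] (h : Function.Injective (algebraMap A B)) :
    ringKrullDim B = ringKrullDim A := by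
  apply le_antisymm
  · refine Order.krullDim_le_of_strictMono (PrimeSpectrum.comap (algebraMap A B)) ?_
    intro I J hIJ
    exact Ideal.IsIntegral.comap_lt_comap (R := A) (I := I.asIdeal) (J := J.asIdeal) hIJ
  · refine iSup_le fun l => ?_
    have : FaithfulSMul A B := (faithfulSMul_iff_algebraMap_injective A B).mpr h
    obtain ⟨Q, hQ⟩ := (Algebra.IsIntegral.comap_surjective A B) l.head
    have : Q.asIdeal.LiesOver l.head.asIdeal := ⟨by rw [← hQ]; rfl⟩
    obtain ⟨L, hL, -, -⟩ := Ideal.exists_ltSeries_of_hasGoingUp (S := B) l Q.asIdeal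
    rw [← hL]
    exact le_iSup (fun L : LTSeries (PrimeSpectrum B) => (L.length : WithBot ℕ∞)) L

lemma exists_dvd_all {ι A : Type*} [CommRing A] (hA : ∀ a b : A, a ∣ b ∨ b ∣ a) (f : ι → A)
    (s : Finset ι) (hs : s.Nonempty) : ∃ i ∈ s, ∀ j ∈ s, f i ∣ f j := by
  classical
  induction hs using Finset.Nonempty.cons_induction with
  | singleton a => exact ⟨a, by simp, by simp⟩
  | cons a s ha hs ih =>
    obtain ⟨i, hi, h⟩ := ih
    rcases hA (f i) (f a) with h' | h'
    · exact ⟨i, by simp [hi], by simpa [h'] using h⟩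
    · exact ⟨a, by simp, by simpa using fun j hj => h'.trans (h j hj)⟩

lemma exists_scaled {R σ : Type*} [CommRing R] [IsDomain R] (p : Ideal R) [p.IsPrime]
    [hv : PreValuationRing (Localization.AtPrime p)] (P : MvPolynomial σ R) (hP : P ≠ 0) :
    ∃ (a s : R) (P' : MvPolynomial σ R) (m : σ →₀ ℕ), a ≠ 0 ∧
      MvPolynomial.C s * P = MvPolynomial.C a * P' ∧ P'.coeff m ∉ p := by
  classical
  have htot : ∀ a b : Localization.AtPrime p, a ∣ b ∨ b ∣ a :=
    (PreValuationRing.iff_dvd_total.mp hv).total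
  obtain ⟨m, hm, hmin⟩ := exists_dvd_all htot
    (fun m => algebraMap R (Localization.AtPrime p) (P.coeff m)) P.support
    (MvPolynomial.support_nonempty.mpr hP)
  have ha : P.coeff m ≠ 0 := MvPolynomial.mem_support_iff.mp hm
  have key : ∀ n, ∃ t ∉ p, P.coeff m ∣ t * P.coeff n := by
    intro n
    by_cases hn : n ∈ P.support
    · obtain ⟨c, hc⟩ := hmin n hn
      obtain ⟨c, t, rfl⟩ := IsLocalization.exists_mk'_eq p.primeCompl c
      refine ⟨t, t.2, c, ?_⟩
      rw [eq_comm, IsLocalization.mul_mk'_eq_mk'_of_mul, IsLocalization.mk'_eq_iff_eq_mul,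
        ← map_mul] at hc
      have := IsLocalization.injective (Localization.AtPrime p)
        (p.primeCompl_le_nonZeroDivisors) hc
      rw [mul_comm, this]
    · exact ⟨1, p.primeCompl.one_mem, by simp [MvPolynomial.notMem_support_iff.mp hn]⟩
  choose t ht hdvd using key
  have hs : (∏ n ∈ P.support, t n) ∉ p := p.primeCompl.prod_mem (fun n _ => ht n)
  set s := ∏ n ∈ P.support, t n
  have h1 : MvPolynomial.C (P.coeff m) ∣ MvPolynomial.C s * P := by
    rw [MvPolynomial.C_dvd_iff_dvd_coeff]
    intro n
    rw [MvPolynomial.coeff_C_mul]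
    by_cases hn : n ∈ P.support
    · exact (hdvd n).trans (mul_dvd_mul_right (Finset.dvd_prod_of_mem _ hn) _)
    · simp [MvPolynomial.notMem_support_iff.mp hn]
  obtain ⟨P', hP'⟩ := h1
  refine ⟨P.coeff m, s, P', m, ha, hP', ?_⟩
  have := congrArg (MvPolynomial.coeff m) hP'
  rw [MvPolynomial.coeff_C_mul, MvPolynomial.coeff_C_mul, mul_comm] at this
  rwa [← mul_left_cancel₀ ha this]

/-- algebraic independence lifts from the fibre. -/
lemma algebraicIndependent_of_fiber {R B ι : Type*} [CommRing R] [IsDomain R] [CommRing B]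
    [IsDomain B] [Algebra R B] [FaithfulSMul R B] (p : Ideal R) [p.IsPrime]
    [hv : PreValuationRing (Localization.AtPrime p)] (b : ι → B)
    (h : AlgebraicIndependent p.ResidueField (fun i => (1 ⊗ₜ b i : p.Fiber B))) :
    AlgebraicIndependent R b := by
  rw [algebraicIndependent_iff]
  intro P hP
  by_contra hne
  obtain ⟨a, s, P', m, ha, hs, hm⟩ := exists_scaled p P hne
  have h1 : MvPolynomial.aeval b P' = 0 := by
    have := congrArg (MvPolynomial.aeval b) hs
    rw [map_mul, hP, mul_zero, map_mul, MvPolynomial.aeval_C, eq_comm, mul_eq_zero] at this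
    refine this.resolve_left ?_
    intro h
    exact ha ((FaithfulSMul.algebraMap_eq_zero_iff R B).mp h)
  have h2 : MvPolynomial.map (algebraMap R p.ResidueField) P' = 0 := by
    rw [algebraicIndependent_iff] at h
    apply h
    rw [MvPolynomial.aeval_map_algebraMap]
    have := congrArg (Algebra.TensorProduct.includeRight : B →ₐ[R] p.Fiber B) h1
    rw [MvPolynomial.comp_aeval_apply] at this
    simpa using this
  have h3 := congrArg (MvPolynomial.coeff m) h2
  rw [MvPolynomial.coeff_map, MvPolynomial.coeff_zero, Ideal.algebraMap_residueField_eq_zero] at h3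
  exact hm h3

/-- descent of weak quasi-finiteness from the fibre over `R`. -/
lemma weaklyQF {R A B : Type*} [CommRing R] [CommRing A] [CommRing B] [Algebra R A] [Algebra R B]
    [Algebra A B] [IsScalarTower R A B] (p : Ideal R) [p.IsPrime] (q : Ideal B) [q.IsPrime]
    (hq : q.under R = p) [Algebra A (p.Fiber B)]
    (hA : ∀ a, algebraMap A (p.Fiber B) a = 1 ⊗ₜ algebraMap A B a)
    [Algebra.QuasiFinite A (p.Fiber B)] : Algebra.WeaklyQuasiFiniteAt A q := by
  rw [Algebra.weaklyQuasiFiniteAt_iff]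
  let Bq := Localization.AtPrime q
  let I := (q.under A).map (algebraMap A Bq)
  let φ₁ : p.ResidueField →ₐ[R] Bq ⧸ I := Ideal.ResidueField.liftₐ p (Algebra.ofId R (Bq ⧸ I))
    (by
      intro r hr
      have h1 : algebraMap R A r ∈ q.under A := by
        rw [← hq] at hr
        simpa [Ideal.under, ← IsScalarTower.algebraMap_apply] using hr
      have h2 : algebraMap R Bq r ∈ I := by
        rw [IsScalarTower.algebraMap_apply R A Bq]
        exact Ideal.mem_map_of_mem _ h1
      rw [RingHom.mem_ker]
      change Ideal.Quotient.mk I (algebraMap R Bq r) = 0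
      exact Ideal.Quotient.eq_zero_iff_mem.mpr h2)
    (by
      intro r hr
      have h1 : algebraMap R B r ∈ q.primeCompl := by
        intro h
        apply hr
        rw [← hq]
        exact h
      have h2 := (IsLocalization.map_units Bq (⟨_, h1⟩ : q.primeCompl)).map (Ideal.Quotient.mk I)
      simp only [← IsScalarTower.algebraMap_apply] at h2
      exact h2)
  let φ₂ : p.Fiber B →ₐ[R] Bq ⧸ I :=
    Algebra.TensorProduct.lift φ₁ (IsScalarTower.toAlgHom R B (Bq ⧸ I)) fun _ _ ↦ .all _ _
  have hφ₂ : ∀ b : B, φ₂ (1 ⊗ₜ b) = Ideal.Quotient.mk I (algebraMap B Bq b) := by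
    intro b
    simp only [φ₂, Algebra.TensorProduct.lift_tmul, map_one, one_mul]
    rfl
  let φ : p.Fiber B →ₐ[A] Bq ⧸ I := { φ₂.toRingHom with
    commutes' := by
      intro a
      change φ₂ (algebraMap A (p.Fiber B) a) = _
      rw [hA, hφ₂, ← IsScalarTower.algebraMap_apply]
      rfl }
  refine Algebra.QuasiFinite.of_forall_exists_mul_mem_range φ ?_
  intro x
  obtain ⟨x, rfl⟩ := Ideal.Quotient.mk_surjective x
  obtain ⟨x, s, rfl⟩ := IsLocalization.exists_mk'_eq q.primeCompl x
  refine ⟨1 ⊗ₜ (s : B), ?_, 1 ⊗ₜ x, ?_⟩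
  · change IsUnit (φ₂ _)
    rw [hφ₂]
    exact (IsLocalization.map_units Bq s).map _
  · change φ₂ _ = _ * φ₂ _
    rw [hφ₂, hφ₂, ← map_mul, IsLocalization.mk'_spec]

end PruferAux

namespace PruferAux
open scoped TensorProduct

lemma exists_noether {R C : Type*} [CommRing R] [CommRing C] [Algebra R C] [Algebra.FiniteType R C]
    (p : Ideal R) [p.IsPrime] [Nontrivial (p.Fiber C)] :
    ∃ (s : ℕ) (b : Fin s → C),
      Function.Injective (MvPolynomial.aeval (R := p.ResidueField)
        (fun i => (1 ⊗ₜ b i : p.Fiber C))) ∧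
      (MvPolynomial.aeval (R := p.ResidueField) (fun i => (1 ⊗ₜ b i : p.Fiber C))).Finite := by
  obtain ⟨s, g, hg, hgf⟩ := exists_finite_inj_algHom_of_fg p.ResidueField (p.Fiber C)
  choose r hr b hb using fun i => Ideal.Fiber.exists_smul_eq_one_tmul p (g (MvPolynomial.X i))
  let c : Fin s → p.ResidueField := fun i => algebraMap R p.ResidueField (r i)
  have hc : ∀ i, c i ≠ 0 := fun i h => hr i (Ideal.algebraMap_residueField_eq_zero.mp h)
  let σ₁ : MvPolynomial (Fin s) p.ResidueField →ₐ[p.ResidueField]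
      MvPolynomial (Fin s) p.ResidueField :=
    MvPolynomial.aeval (fun i => MvPolynomial.C (c i) * MvPolynomial.X i)
  let σ₂ : MvPolynomial (Fin s) p.ResidueField →ₐ[p.ResidueField]
      MvPolynomial (Fin s) p.ResidueField :=
    MvPolynomial.aeval (fun i => MvPolynomial.C (c i)⁻¹ * MvPolynomial.X i)
  have h12 : σ₁.comp σ₂ = AlgHom.id _ _ := by
    apply MvPolynomial.algHom_ext
    intro i
    simp only [σ₁, σ₂, AlgHom.comp_apply, MvPolynomial.aeval_X, map_mul, MvPolynomial.algHom_C,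
      MvPolynomial.algebraMap_eq, AlgHom.id_apply, ← mul_assoc]
    rw [← map_mul, inv_mul_cancel₀ (hc i), map_one, one_mul]
  have h21 : σ₂.comp σ₁ = AlgHom.id _ _ := by
    apply MvPolynomial.algHom_ext
    intro i
    simp only [σ₁, σ₂, AlgHom.comp_apply, MvPolynomial.aeval_X, map_mul, MvPolynomial.algHom_C,
      MvPolynomial.algebraMap_eq, AlgHom.id_apply, ← mul_assoc]
    rw [← map_mul, mul_inv_cancel₀ (hc i), map_one, one_mul]
  let e := AlgEquiv.ofAlgHom σ₁ σ₂ h12 h21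
  have he : MvPolynomial.aeval (R := p.ResidueField) (fun i => (1 ⊗ₜ b i : p.Fiber C)) =
      g.comp σ₁ := by
    apply MvPolynomial.algHom_ext
    intro i
    simp only [σ₁, AlgHom.comp_apply, MvPolynomial.aeval_X, map_mul]
    rw [← hb i, MvPolynomial.algHom_C, Algebra.smul_def]
    rfl
  refine ⟨s, b, ?_, ?_⟩
  · rw [he]
    exact hg.comp e.injective
  · rw [he]
    exact hgf.comp (AlgHom.Finite.of_surjective _ e.surjective)

lemma quasiFinite_fiber {R C : Type*} [CommRing R] [CommRing C] [Algebra R C]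
    (p : Ideal R) [p.IsPrime] (s : ℕ) (b : Fin s → C)
    (h : (MvPolynomial.aeval (R := p.ResidueField) (fun i => (1 ⊗ₜ b i : p.Fiber C))).Finite)
    [Algebra (MvPolynomial (Fin s) R) (p.Fiber C)]
    (hA : ∀ a, algebraMap (MvPolynomial (Fin s) R) (p.Fiber C) a = 1 ⊗ₜ MvPolynomial.aeval b a) :
    Algebra.QuasiFinite (MvPolynomial (Fin s) R) (p.Fiber C) := by
  let A := MvPolynomial (Fin s) R
  have hqf : Algebra.QuasiFinite A (A ⊗[R] p.ResidueField) := inferInstance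
  have : IsScalarTower R A (p.Fiber C) := .of_algebraMap_eq fun r => by
    rw [hA]
    rw [MvPolynomial.algebraMap_eq, MvPolynomial.aeval_C]
    rw [Algebra.TensorProduct.algebraMap_apply, ← mul_one (algebraMap R C r), ← Algebra.smul_def,
      TensorProduct.tmul_smul, TensorProduct.smul_tmul', Algebra.smul_def, mul_one]
  let φ : A ⊗[R] p.ResidueField →ₐ[A] p.Fiber C :=
    Algebra.TensorProduct.lift (Algebra.ofId A _)
      (Algebra.TensorProduct.includeLeft : p.ResidueField →ₐ[R] p.Fiber C) fun _ _ ↦ .all _ _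
  have hφ : φ.toRingHom.Finite := by
    refine RingHom.Finite.of_comp_finite (f := MvPolynomial.eval₂Hom
      (Algebra.TensorProduct.includeRight : p.ResidueField →ₐ[R] A ⊗[R] p.ResidueField).toRingHom
      (fun i => (MvPolynomial.X i : A) ⊗ₜ 1)) ?_
    have key : φ.toRingHom.comp (MvPolynomial.eval₂Hom
      (Algebra.TensorProduct.includeRight : p.ResidueField →ₐ[R] A ⊗[R] p.ResidueField).toRingHom
      (fun i => (MvPolynomial.X i : A) ⊗ₜ 1)) = (MvPolynomial.aeval (R := p.ResidueField)
        (fun i => (1 ⊗ₜ b i : p.Fiber C))).toRingHom := ?_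
    · rw [key]
      exact h
    apply MvPolynomial.ringHom_ext
    · intro r
      simp [φ]
    · intro i
      simp [φ, Algebra.ofId_apply]
      rw [← Algebra.TensorProduct.one_def, mul_one]
      exact (hA _).trans (by rw [MvPolynomial.aeval_X])
  algebraize [φ.toRingHom]
  have : IsScalarTower A (A ⊗[R] p.ResidueField) (p.Fiber C) := .of_algebraMap_eq fun r => by
    exact (φ.commutes r).symm
  exact Algebra.QuasiFinite.trans A (A ⊗[R] p.ResidueField) _

lemma exists_prime_over {R C : Type*} [CommRing R] [CommRing C] [Algebra R C]
    (p : Ideal R) [hp : p.IsPrime] [Nontrivial (p.Fiber C)] :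
    ∃ q : Ideal C, q.IsPrime ∧ q.under R = p := by
  obtain ⟨x⟩ : Nonempty (PrimeSpectrum (p.Fiber C)) := inferInstance
  let y := (PrimeSpectrum.preimageHomeomorphFiber R C ⟨p, hp⟩).symm x
  refine ⟨y.1.asIdeal, y.1.2, ?_⟩
  exact congrArg PrimeSpectrum.asIdeal y.2

theorem dim_fiber {R C : Type*} [CommRing R] [IsDomain R] [CommRing C] [IsDomain C]
    [Algebra R C] [FaithfulSMul R C] [Algebra.FiniteType R C]
    (p : Ideal R) [hp : p.IsPrime] [hv : PreValuationRing (Localization.AtPrime p)]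
    [Nontrivial (p.Fiber C)] :
    ringKrullDim (p.Fiber C) = ((Cardinal.toNat (Algebra.trdeg R C) : ℕ) : WithBot ℕ∞) := by
  obtain ⟨s, b, hinj, hfin⟩ := exists_noether (C := C) p
  have hdim : ringKrullDim (p.Fiber C) = (s : WithBot ℕ∞) := by
    let g := MvPolynomial.aeval (R := p.ResidueField) (fun i => (1 ⊗ₜ b i : p.Fiber C))
    have hg : g.toRingHom.Finite := hfin
    algebraize [g.toRingHom]
    have : Algebra.IsIntegral (MvPolynomial (Fin s) p.ResidueField) (p.Fiber C) :=
      Algebra.IsIntegral.of_finite _ _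
    rw [ringKrullDim_eq_of_isIntegral (A := MvPolynomial (Fin s) p.ResidueField) hinj,
      MvPolynomial.ringKrullDim_of_isNoetherianRing, ringKrullDim_eq_zero_of_field]
    simp
  have hind : AlgebraicIndependent R b := algebraicIndependent_of_fiber p b hinj
  have halg : Algebra.IsAlgebraic (Algebra.adjoin R (Set.range b)) C := by
    let A := MvPolynomial (Fin s) R
    obtain ⟨q, hq, hqp⟩ := exists_prime_over (C := C) p
    let S := Algebra.adjoin R (Set.range b)
    let α : A →ₐ[R] C := MvPolynomial.aeval b
    let β : A →ₐ[R] S := α.codRestrict S (fun x => by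
      simp only [S, Algebra.adjoin_range_eq_range_aeval]
      exact ⟨x, rfl⟩)
    let _ : Algebra A C := α.toRingHom.toAlgebra
    let _ : Algebra A S := β.toRingHom.toAlgebra
    have : IsScalarTower A S C := .of_algebraMap_eq fun _ => rfl
    have : IsScalarTower R A C := .of_algebraMap_eq fun x => (α.commutes x).symm
    let _ : Algebra A (p.Fiber C) :=
      ((Algebra.TensorProduct.includeRight : C →ₐ[R] p.Fiber C).comp α).toRingHom.toAlgebra
    have hA : ∀ a, algebraMap A (p.Fiber C) a = 1 ⊗ₜ algebraMap A C a := fun _ => rfl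
    have : Algebra.QuasiFinite A (p.Fiber C) := quasiFinite_fiber p s b hfin hA
    have : Algebra.WeaklyQuasiFiniteAt A q := weaklyQF p q hqp hA
    have : Algebra.FiniteType A C := .of_restrictScalars_finiteType R A C
    obtain ⟨r, hr, hri, hrx⟩ := Algebra.zariskisMainProperty_iff.mp
      (Algebra.ZariskisMainProperty.of_finiteType_of_weaklyQuasiFiniteAt (R := A) q)
    have hr0 : r ≠ 0 := fun h => hr (h ▸ q.zero_mem)
    refine ⟨fun x => ?_⟩
    obtain ⟨m, hm⟩ := hrx x
    have h1 : IsAlgebraic S (r ^ m * x) := (hm.tower_top (A := S)).isAlgebraic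
    have h2 : IsAlgebraic S (r ^ m) := ((hri.pow m).tower_top (A := S)).isAlgebraic
    exact IsAlgebraic.of_mul (mem_nonZeroDivisors_of_ne_zero (pow_ne_zero m hr0)) h2 h1
  have hcard := (hind.isTranscendenceBasis_iff_isAlgebraic.mpr halg).lift_cardinalMk_eq_trdeg
  rw [hdim]
  congr 1
  have := congrArg Cardinal.toNat hcard
  simpa using this

end PruferAux

namespace PruferAux
open scoped TensorProduct

lemma topologicalKrullDim_le_of_cover {Y : Type*} [TopologicalSpace Y] (n : WithBot ℕ∞)
    (h : ∀ y : Y, ∃ U : Set Y, IsOpen U ∧ y ∈ U ∧ topologicalKrullDim U ≤ n) :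
    topologicalKrullDim Y ≤ n := by
  unfold topologicalKrullDim
  rw [Order.krullDim_eq_iSup_coheight]
  refine iSup_le fun Z => ?_
  obtain ⟨y, hy⟩ := Z.isIrreducible.nonempty
  obtain ⟨U, hU, hyU, hn⟩ := h y
  refine le_trans ?_ hn
  let W := (TopologicalSpace.IrreducibleCloseds.orderIsoOfIsOpenEmbedding
    (Subtype.val : U → Y) hU.isOpenEmbedding_subtypeVal).symm ⟨Z, ⟨⟨y, hyU⟩, hy⟩⟩
  have h1 : TopologicalSpace.IrreducibleCloseds.map (Subtype.val : U → Y)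
      hU.isOpenEmbedding_subtypeVal.continuous W = Z := by
    have := (TopologicalSpace.IrreducibleCloseds.orderIsoOfIsOpenEmbedding
      (Subtype.val : U → Y) hU.isOpenEmbedding_subtypeVal).apply_symm_apply ⟨Z, ⟨⟨y, hyU⟩, hy⟩⟩
    exact congrArg Subtype.val this
  rw [← h1, hU.isOpenEmbedding_subtypeVal.coheight_map]
  exact Order.coheight_le_krullDim W

lemma dim_chart_domain {R C X : Type*} [CommRing R] [IsDomain R] [CommRing C] [IsDomain C]
    [Algebra R C] [FaithfulSMul R C] [Algebra.FiniteType R C] [TopologicalSpace X]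
    (hR : ∀ (P : Ideal R) [P.IsPrime], PreValuationRing (Localization.AtPrime P))
    (e : PrimeSpectrum C → X) (he : Topology.IsEmbedding e) (F : X → PrimeSpectrum R)
    (hF : ∀ x, F (e x) = PrimeSpectrum.comap (algebraMap R C) x) (γ : PrimeSpectrum R)
    (hne : (Set.range e ∩ F ⁻¹' {γ}).Nonempty) :
    topologicalKrullDim ↥(Set.range e ∩ F ⁻¹' {γ}) =
      ((Cardinal.toNat (Algebra.trdeg R C) : ℕ) : WithBot ℕ∞) := by
  have hv := hR γ.asIdeal
  let φ : ↥(PrimeSpectrum.comap (algebraMap R C) ⁻¹' {γ}) → ↥(Set.range e ∩ F ⁻¹' {γ}) :=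
    fun x => ⟨e x.1, ⟨x.1, rfl⟩, (hF x.1).trans x.2⟩
  have hφi : Topology.IsInducing φ := by
    rw [← Topology.IsInducing.subtypeVal.of_comp_iff]
    exact he.isInducing.comp Topology.IsInducing.subtypeVal
  have hφ : IsHomeomorph φ := by
    rw [isHomeomorph_iff_isEmbedding_surjective]
    refine ⟨⟨hφi, ?_⟩, ?_⟩
    · intro x y h
      exact Subtype.ext (he.injective (congrArg Subtype.val h))
    · rintro ⟨_, ⟨x, rfl⟩, hx⟩
      exact ⟨⟨x, (hF x).symm.trans hx⟩, rfl⟩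
  obtain ⟨_, ⟨x, rfl⟩, hx⟩ := hne
  have hx' : PrimeSpectrum.comap (algebraMap R C) x = γ := (hF x).symm.trans hx
  have : Nontrivial (γ.asIdeal.Fiber C) := by
    have := PrimeSpectrum.preimageHomeomorphFiber R C γ ⟨x, hx'⟩
    exact PrimeSpectrum.nontrivial this
  rw [← hφ.topologicalKrullDim_eq,
    (PrimeSpectrum.preimageHomeomorphFiber R C γ).isHomeomorph.topologicalKrullDim_eq,
    PrimeSpectrum.topologicalKrullDim_eq_ringKrullDim]
  exact dim_fiber γ.asIdeal

lemma trdeg_away {R C : Type u} [CommRing R] [IsDomain R] [CommRing C] [IsDomain C]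
    [Algebra R C] [FaithfulSMul R C] (g : C) (hg : g ≠ 0) :
    Algebra.trdeg R (Localization.Away g) = Algebra.trdeg R C := by
  have hle : Submonoid.powers g ≤ nonZeroDivisors C :=
    powers_le_nonZeroDivisors_of_noZeroDivisors hg
  have : IsDomain (Localization.Away g) :=
    IsLocalization.isDomain_localization hle
  have : FaithfulSMul C (Localization.Away g) :=
    (faithfulSMul_iff_algebraMap_injective _ _).mpr (IsLocalization.injective _ hle)
  have : Algebra.IsAlgebraic C (Localization.Away g) :=
    IsLocalization.isAlgebraic (R := C) (S := Localization.Away g) (M := Submonoid.powers g)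
  rw [← trdeg_add_eq R C (A := Localization.Away g), trdeg_eq_zero (R := C), add_zero]

theorem dim_chart {R B : Type u} {X : Type*} [CommRing R] [IsDomain R] [CommRing B]
    [Algebra R B] [Algebra.FiniteType R B] [TopologicalSpace X]
    (hR : ∀ (P : Ideal R) [P.IsPrime], PreValuationRing (Localization.AtPrime P))
    [hirr : IrreducibleSpace (PrimeSpectrum B)]
    (hd : DenseRange (PrimeSpectrum.comap (algebraMap R B)))
    (e : PrimeSpectrum B → X) (he : Topology.IsEmbedding e) (F : X → PrimeSpectrum R)
    (hF : ∀ x, F (e x) = PrimeSpectrum.comap (algebraMap R B) x) :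
    ∃ n : ℕ, (∀ γ, (Set.range e ∩ F ⁻¹' {γ}).Nonempty →
      topologicalKrullDim ↥(Set.range e ∩ F ⁻¹' {γ}) = n) ∧
      ∀ g : B, (PrimeSpectrum.basicOpen g : Set (PrimeSpectrum B)).Nonempty →
      ∀ η : PrimeSpectrum R, η.asIdeal = ⊥ →
        topologicalKrullDim ↥(e '' (PrimeSpectrum.basicOpen g) ∩ F ⁻¹' {η}) = n := by
  let C := B ⧸ nilradical B
  have hprime : (nilradical B).IsPrime :=
    PrimeSpectrum.irreducibleSpace_iff_isPrime_nilradical.mp hirr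
  have hker : RingHom.ker (algebraMap R B) ≤ nilradical R :=
    PrimeSpectrum.denseRange_comap_iff_ker_le_nilRadical _ |>.mp hd
  have hker' : Function.Injective (algebraMap R C) := by
    rw [injective_iff_map_eq_zero]
    intro r hr
    have h1 : algebraMap R B r ∈ nilradical B := Ideal.Quotient.eq_zero_iff_mem.mp hr
    obtain ⟨k, hk⟩ := h1
    rw [← map_pow] at hk
    have := hker hk
    rw [nilradical_eq_zero] at this
    have h0 : r ^ k = 0 := this
    by_contra hne
    exact pow_ne_zero k hne h0
  have : FaithfulSMul R C := (faithfulSMul_iff_algebraMap_injective _ _).mpr hker'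
  let m : PrimeSpectrum C → PrimeSpectrum B := PrimeSpectrum.comap (Ideal.Quotient.mk _)
  have hm : Topology.IsClosedEmbedding m :=
    PrimeSpectrum.isClosedEmbedding_comap_of_surjective _ _ Ideal.Quotient.mk_surjective
  have hmr : Function.Surjective m := by
    rw [← Set.range_eq_univ]
    simp only [m]
    rw [range_comap_of_surjective _ _ Ideal.Quotient.mk_surjective, Ideal.mk_ker,
      PrimeSpectrum.zeroLocus_nilradical]
  have hr : Set.range (e ∘ m) = Set.range e := hmr.range_comp e
  refine ⟨Cardinal.toNat (Algebra.trdeg R C), fun γ hne => ?_, fun g hg η hη => ?_⟩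
  · rw [← hr] at hne ⊢
    exact dim_chart_domain hR (e ∘ m) (he.comp hm.isEmbedding) F (fun x => hF _) γ hne
  · let g' : C := Ideal.Quotient.mk _ g
    have hg' : g' ≠ 0 := by
      intro h
      have := Ideal.Quotient.eq_zero_iff_mem.mp h
      obtain ⟨x, hx⟩ := hg
      exact hx (nilradical_le_prime x.asIdeal this)
    have hle : Submonoid.powers g' ≤ nonZeroDivisors C :=
      powers_le_nonZeroDivisors_of_noZeroDivisors hg'
    have : IsDomain (Localization.Away g') := IsLocalization.isDomain_localization hle
    have hi : Function.Injective (algebraMap C (Localization.Away g')) :=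
      IsLocalization.injective _ hle
    have hRi : Function.Injective (algebraMap R (Localization.Away g')) := by
      rw [IsScalarTower.algebraMap_eq R C]
      exact hi.comp hker'
    have : FaithfulSMul R (Localization.Away g') :=
      (faithfulSMul_iff_algebraMap_injective _ _).mpr hRi
    have : Algebra.FiniteType C (Localization.Away g') :=
      IsLocalization.finiteType_of_monoid_fg (Submonoid.powers g') _
    have : Algebra.FiniteType R (Localization.Away g') := .trans (S := C) inferInstance inferInstance
    let l : PrimeSpectrum (Localization.Away g') → PrimeSpectrum C :=
      PrimeSpectrum.comap (algebraMap _ _)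
    have hl : Topology.IsOpenEmbedding l :=
      PrimeSpectrum.localization_away_isOpenEmbedding _ g'
    have hlr : Set.range (e ∘ m ∘ l) = e '' (PrimeSpectrum.basicOpen g) := by
      rw [Set.range_comp, Set.range_comp]
      congr 1
      simp only [l]
      rw [PrimeSpectrum.localization_away_comap_range _ g']
      have : (PrimeSpectrum.basicOpen g' : Set (PrimeSpectrum C)) =
        m ⁻¹' (PrimeSpectrum.basicOpen g) := rfl
      rw [this, Set.image_preimage_eq _ hmr]
    rw [← hlr, ← trdeg_away g' hg']
    refine dim_chart_domain hR (e ∘ m ∘ l)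
      (he.comp (hm.isEmbedding.comp hl.isEmbedding)) F (fun x => hF _) η ?_
    refine ⟨_, ⟨⟨⊥, Ideal.isPrime_bot⟩, rfl⟩, ?_⟩
    refine (hF _).trans ?_
    ext1
    rw [hη]
    change Ideal.comap (algebraMap R (Localization.Away g')) ⊥ = ⊥
    exact (RingHom.injective_iff_ker_eq_bot _).mp hRi

end PruferAux

namespace PruferAux

theorem dim_affine {R : Type u} [CommRing R] [IsDomain R]
    (hR : ∀ (P : Ideal R) [P.IsPrime], PreValuationRing (Localization.AtPrime P))
    (X : Scheme.{u}) [IrreducibleSpace X] (f : X ⟶ Spec (CommRingCat.of R))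
    [LocallyOfFiniteType f] (hdom : DenseRange f)
    (U : X.Opens) (hU : IsAffineOpen U) (hne : (U : Set X).Nonempty) :
    ∃ n : ℕ, (∀ γ, ((U : Set X) ∩ f ⁻¹' {γ}).Nonempty →
      topologicalKrullDim ↥((U : Set X) ∩ f ⁻¹' {γ}) = n) ∧
      ∀ g : Γ(X, U), (X.basicOpen g : Set X).Nonempty →
      ∀ η : PrimeSpectrum R, η.asIdeal = ⊥ →
        topologicalKrullDim ↥((X.basicOpen g : Set X) ∩ f ⁻¹' {η}) = n := by
  let φ : CommRingCat.of R ⟶ Γ(X, U) := Spec.preimage (hU.fromSpec ≫ f)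
  have hφ : Spec.map φ = hU.fromSpec ≫ f := Spec.map_preimage _
  have hft : RingHom.FiniteType φ.hom := by
    rw [← HasRingHomProperty.Spec_iff (P := @LocallyOfFiniteType), hφ]
    infer_instance
  algebraize [φ.hom]
  let e : PrimeSpectrum Γ(X, U) → X := fun x => hU.fromSpec x
  have hF : ∀ x : PrimeSpectrum Γ(X, U), f (e x) =
      PrimeSpectrum.comap (algebraMap R Γ(X, U)) x := by
    intro x
    have h0 : f (e x) = (hU.fromSpec ≫ f) x := rfl
    rw [← hφ] at h0
    exact h0
  have he : Topology.IsOpenEmbedding e := hU.fromSpec.isOpenEmbedding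
  have hrange : Set.range e = U := hU.range_fromSpec
  have hirr : IrreducibleSpace (PrimeSpectrum Γ(X, U)) := by
    have : Nonempty (PrimeSpectrum Γ(X, U)) := by
      obtain ⟨x, hx⟩ := hne
      rw [← hrange] at hx
      exact ⟨hx.choose⟩
    have : PreirreducibleSpace (PrimeSpectrum Γ(X, U)) := by
      refine PreirreducibleSpace.of_forall_nonempty_inter ?_
      intro s t hs ht hsn htn
      obtain ⟨x, ⟨y, hy, hyx⟩, z, hz, hzx⟩ := nonempty_preirreducible_inter (he.isOpenMap s hs)
        (he.isOpenMap t ht) (hsn.image _) (htn.image _)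
      obtain rfl := he.injective (hyx.trans hzx.symm)
      exact ⟨y, hy, hz⟩
    exact { toPreirreducibleSpace := this, toNonempty := inferInstance }
  have hd : DenseRange (PrimeSpectrum.comap (algebraMap R Γ(X, U))) := by
    have h1 : Dense (U : Set X) := U.isOpen.dense hne
    have h2 := hdom.dense_image f.continuous h1
    refine h2.mono ?_
    rintro _ ⟨x, hx, rfl⟩
    rw [← hrange] at hx
    obtain ⟨y, rfl⟩ := hx
    exact ⟨y, (hF y).symm⟩
  obtain ⟨n, h1, h2⟩ := dim_chart hR hd e he.isEmbedding f hF
  rw [hrange] at h1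
  refine ⟨n, h1, fun g hg η hη => ?_⟩
  have hb : e '' (PrimeSpectrum.basicOpen g) = (X.basicOpen g : Set X) :=
    congrArg (fun V : X.Opens => (V : Set X)) (hU.fromSpec_image_basicOpen g)
  rw [← hb] at hg ⊢
  exact h2 g hg.of_image η hη

theorem dim_fibers {R : Type u} [CommRing R] [IsDomain R]
    (hR : ∀ (P : Ideal R) [P.IsPrime], PreValuationRing (Localization.AtPrime P))
    (X : Scheme.{u}) [IrreducibleSpace X] (f : X ⟶ Spec (CommRingCat.of R))
    [LocallyOfFiniteType f] (hdom : DenseRange f) (η : PrimeSpectrum R) (hη : η.asIdeal = ⊥) :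
    (f ⁻¹' {η}).Nonempty ∧ ∃ n : ℕ, ∀ γ : PrimeSpectrum R, (f ⁻¹' {γ}).Nonempty →
      topologicalKrullDim ↥(f ⁻¹' {γ}) = n := by
  have key : (f ⁻¹' {η}).Nonempty ∧ ∃ n : ℕ, ∀ (U : X.Opens), IsAffineOpen U → (U : Set X).Nonempty →
      ∀ γ, ((U : Set X) ∩ f ⁻¹' {γ}).Nonempty →
        topologicalKrullDim ↥((U : Set X) ∩ f ⁻¹' {γ}) = n := by
    obtain ⟨x₀⟩ : Nonempty X := inferInstance
    obtain ⟨_, ⟨U₀, hU₀, rfl⟩, hx₀, -⟩ :=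
      X.isBasis_affineOpens.exists_subset_of_mem_open (Set.mem_univ x₀) isOpen_univ
    obtain ⟨n, hn, hn'⟩ := dim_affine hR X f hdom U₀ hU₀ ⟨x₀, hx₀⟩
    refine ⟨?_, n, fun U hU hne => ?_⟩
    · by_contra hemp
      have h1 := hn' 1 ⟨x₀, by simpa using hx₀⟩ η hη
      rw [Set.not_nonempty_iff_eq_empty] at hemp
      have hE : IsEmpty ↥((X.basicOpen (1 : Γ(X, U₀)) : Set X) ∩ f ⁻¹' {η}) := by
        rw [hemp, Set.inter_empty]
        infer_instance
      have hE' : IsEmpty (TopologicalSpace.IrreducibleCloseds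
          ↥((X.basicOpen (1 : Γ(X, U₀)) : Set X) ∩ f ⁻¹' {η})) :=
        ⟨fun Z => hE.elim Z.isIrreducible.nonempty.some⟩
      rw [topologicalKrullDim, Order.krullDim_eq_bot] at h1
      exact absurd h1.symm (WithBot.coe_ne_bot (a := (n : ℕ∞)))
    obtain ⟨m, hm, hm'⟩ := dim_affine hR X f hdom U hU hne
    suffices m = n by rwa [← this]
    obtain ⟨x, hx⟩ := nonempty_preirreducible_inter U₀.isOpen U.isOpen ⟨x₀, hx₀⟩ hne
    obtain ⟨g, h, hgh, hxg⟩ := exists_basicOpen_le_affine_inter hU₀ hU x hx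
    have h1 := hn' g ⟨x, hxg⟩ η hη
    have h2 := hm' h ⟨x, hgh ▸ hxg⟩ η hη
    rw [hgh, h2] at h1
    exact_mod_cast h1
  obtain ⟨hη', n, hn⟩ := key
  refine ⟨hη', n, fun γ hγ => le_antisymm ?_ ?_⟩
  · refine topologicalKrullDim_le_of_cover _ fun y => ?_
    obtain ⟨_, ⟨U, hU, rfl⟩, hx, -⟩ :=
      X.isBasis_affineOpens.exists_subset_of_mem_open (Set.mem_univ y.1) isOpen_univ
    refine ⟨Subtype.val ⁻¹' (U : Set X), U.isOpen.preimage continuous_subtype_val, hx, ?_⟩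
    rw [← hn U hU ⟨y, hx⟩ γ ⟨y, hx, y.2⟩]
    let φ : ↥(Subtype.val ⁻¹' (U : Set X) : Set ↥(f ⁻¹' {γ})) → ↥((U : Set X) ∩ f ⁻¹' {γ}) :=
      fun z => ⟨z.1.1, z.2, z.1.2⟩
    have : Topology.IsInducing φ := by
      have hc0 : Topology.IsInducing (fun z : ↥(Subtype.val ⁻¹' (U : Set X) :
          Set ↥(f ⁻¹' {γ})) => (z.1.1 : X)) :=
        Topology.IsInducing.subtypeVal.comp Topology.IsInducing.subtypeVal
      have hc : Topology.IsInducing (Subtype.val ∘ φ) := hc0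
      exact (Topology.IsInducing.subtypeVal.of_comp_iff).mp hc
    exact this.topologicalKrullDim_le
  · obtain ⟨y, hy⟩ := hγ
    obtain ⟨_, ⟨U, hU, rfl⟩, hx, -⟩ :=
      X.isBasis_affineOpens.exists_subset_of_mem_open (Set.mem_univ y) isOpen_univ
    rw [← hn U hU ⟨y, hx⟩ γ ⟨y, hx, hy⟩]
    exact (Topology.IsEmbedding.inclusion Set.inter_subset_right).isInducing.topologicalKrullDim_le

end PruferAux

/-- let `R` be a Prüfer domain, `γ, η ∈ Spec R` with `η` the generic point
(the zero ideal), and let `f : X → Spec R` be a finite type dominant morphism from an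
irreducible scheme `X`.  If the fibre of `X` over `γ` is nonempty, then the topological
Krull dimension of the fibre over `η` (the base change of `X` along `Spec κ(η) → Spec R`)
equals that of the fibre over `γ`. -/
theorem stmt_1 {R : Type u} [CommRing R] (hR : IsPruferDomain R)
    (γ η : PrimeSpectrum R) (hη : η.asIdeal = ⊥)
    (X : Scheme.{u}) [IrreducibleSpace X]
    (f : X ⟶ Spec (CommRingCat.of R))
    [LocallyOfFiniteType f] [QuasiCompact f]
    (hdom : Dense (Set.range f.base))
    (hne : (f.base ⁻¹' {γ}).Nonempty) :
    topologicalKrullDim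
        (pullback f ((Spec (CommRingCat.of R)).fromSpecResidueField η) : Scheme.{u}) =
      topologicalKrullDim
        (pullback f ((Spec (CommRingCat.of R)).fromSpecResidueField γ) : Scheme.{u}) := by
  have := hR.1
  obtain ⟨hη', n, hn⟩ := PruferAux.dim_fibers hR.2 X f hdom η hη
  have h1 := (f.fiberHomeo η).isHomeomorph.topologicalKrullDim_eq
  have h2 := (f.fiberHomeo γ).isHomeomorph.topologicalKrullDim_eq
  exact h1.trans ((hn η hη').trans ((hn γ hne).symm.trans h2.symm))
end

section
/- Let R be a semilocal Prüfer domain of finite Krull dimension (semilocal meaning R has only finitely many maximal ideals) and let A be an R-algebra of finite type. Then the prime spectrum Spec A, with its Zariski topology, is a noetherian topological space. -/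
theorem prufer_comparable {R : Type*} [CommRing R] (m p q : Ideal R) [m.IsPrime]
    [p.IsPrime] [q.IsPrime] (hm : PreValuationRing (Localization.AtPrime m))
    (hp : p ≤ m) (hq : q ≤ m) : p ≤ q ∨ q ≤ p := by
  have key : ∀ (I : Ideal R) [I.IsPrime], I ≤ m →
      Ideal.comap (algebraMap R (Localization.AtPrime m))
        (I.map (algebraMap R (Localization.AtPrime m))) = I := by
    intro I hI hIm
    refine IsLocalization.under_map_of_isPrime_disjoint m.primeCompl _ hI ?_
    rw [Set.disjoint_left]
    intro x hx hx2
    exact hx (hIm hx2)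
  have htot := PreValuationRing.iff_ideal_total.mp hm
  rcases htot.total (p.map (algebraMap R (Localization.AtPrime m)))
    (q.map (algebraMap R (Localization.AtPrime m))) with h | h
  · left
    rw [← key p hp, ← key q hq]
    exact Ideal.comap_mono h
  · right
    rw [← key p hp, ← key q hq]
    exact Ideal.comap_mono h

theorem prufer_finite_spec {R : Type*} [CommRing R]
    (hR : IsPruferDomain R)
    (hsemilocal : {I : Ideal R | I.IsMaximal}.Finite)
    (hdim : ringKrullDim R < ⊤) : Finite (PrimeSpectrum R) := by
  obtain ⟨hd, hP⟩ := hR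
  have : Finite {I : Ideal R | I.IsMaximal} := hsemilocal
  obtain ⟨n, hn⟩ : ∃ n : ℕ, Order.krullDim (PrimeSpectrum R) ≤ ((n : ℕ∞) : WithBot ℕ∞) := by
    change Order.krullDim (PrimeSpectrum R) < ⊤ at hdim
    generalize Order.krullDim (PrimeSpectrum R) = d at hdim
    induction d using WithBot.recBotCoe with
    | bot => exact ⟨0, bot_le⟩
    | coe d =>
      induction d using ENat.recTopCoe with
      | top => exact absurd hdim (lt_irrefl _)
      | coe n => exact ⟨n, le_rfl⟩
  have hh : ∀ p : PrimeSpectrum R, Order.height p ≤ (n : ℕ∞) := fun p =>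
    WithBot.coe_le_coe.mp ((Order.height_le_krullDim p).trans hn)
  have hlt : ∀ p : PrimeSpectrum R, Order.height p < ⊤ := fun p =>
    (hh p).trans_lt (ENat.coe_lt_top n)
  choose M hM hpM using fun p : PrimeSpectrum R => Ideal.exists_le_maximal p.asIdeal p.2.ne_top
  let f : PrimeSpectrum R → {I : Ideal R | I.IsMaximal} × Fin (n + 1) := fun p =>
    (⟨M p, hM p⟩, ⟨(Order.height p).toNat, Nat.lt_succ_of_le (ENat.toNat_le_of_le_coe (hh p))⟩)
  refine Finite.of_injective f ?_
  intro p q hpq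
  have h1 : M p = M q := congrArg (fun x => x.1.1) hpq
  have h2 : (Order.height p).toNat = (Order.height q).toNat := congrArg (fun x => x.2.1) hpq
  have h3 : Order.height p = Order.height q := by
    rw [← ENat.coe_toNat (hlt p).ne, ← ENat.coe_toNat (hlt q).ne, h2]
  have := (hM p).isPrime
  rcases prufer_comparable (M p) p.asIdeal q.asIdeal (hP _) (hpM p) (h1 ▸ hpM q) with h | h
  · by_contra hne
    have : p < q := lt_of_le_of_ne h hne
    exact (Order.height_strictMono this (hlt p)).ne h3
  · by_contra hne
    have : q < p := lt_of_le_of_ne h (Ne.symm hne)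
    exact (Order.height_strictMono this (hlt q)).ne h3.symm

/-- if `R` is a semilocal Prüfer domain of finite Krull dimension and `A`
is a finite type `R`-algebra, then `Spec A` is a noetherian topological space. -/
theorem stmt_4 {R A : Type*} [CommRing R] [CommRing A] [Algebra R A]
    (hR : IsPruferDomain R)
    (hsemilocal : {I : Ideal R | I.IsMaximal}.Finite)
    (hdim : ringKrullDim R < ⊤)
    (hA : Algebra.FiniteType R A) :
    TopologicalSpace.NoetherianSpace (PrimeSpectrum A) := by
  have hfin := prufer_finite_spec hR hsemilocal hdim
  have hf : ∀ p : PrimeSpectrum R, TopologicalSpace.NoetherianSpace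
      (PrimeSpectrum.comap (algebraMap R A) ⁻¹' {p} : Set (PrimeSpectrum A)) := by
    intro p
    have : IsNoetherianRing (p.asIdeal.Fiber A) :=
      Algebra.FiniteType.isNoetherianRing p.asIdeal.ResidueField _
    exact (TopologicalSpace.noetherianSpace_iff_of_homeomorph
      (PrimeSpectrum.preimageHomeomorphFiber R A p)).mpr inferInstance
  have hU := TopologicalSpace.NoetherianSpace.iUnion
    (fun p : PrimeSpectrum R => PrimeSpectrum.comap (algebraMap R A) ⁻¹' {p})
  have he : (⋃ p : PrimeSpectrum R, PrimeSpectrum.comap (algebraMap R A) ⁻¹' {p}) = Set.univ := by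
    ext x; simp
  rw [he] at hU
  exact TopologicalSpace.noetherian_univ_iff.mp hU
end

section
/- Let R be a Prüfer domain and let A be a finitely presented R-algebra. Then A is a coherent ring; that is, every finitely generated ideal I ⊆ A is finitely presented as an A-module. -/
namespace PruferCoh

open MvPolynomial Filter

lemma cramer {R T : Type*} [CommRing R] [Fintype T] [LinearOrder T] (p : Ideal R) [p.IsPrime]
    (A : Matrix T T R) (hd : ∀ u, A u u ∉ p) (ht : ∀ u v, u < v → A u v ∈ p) (b : T → R) :
    ∃ s, s ∉ p ∧ ∃ c : T → R, Matrix.vecMul c A = s • b := by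
  refine ⟨A.det, ?_, Matrix.vecMul b A.adjugate, ?_⟩
  · intro h
    rw [← Ideal.Quotient.eq_zero_iff_mem, RingHom.map_det, Matrix.det_of_isLowerTriangular] at h
    · rw [Finset.prod_eq_zero_iff] at h
      obtain ⟨i, -, hi⟩ := h
      exact hd i (Ideal.Quotient.eq_zero_iff_mem.1 hi)
    · intro u v huv
      exact Ideal.Quotient.eq_zero_iff_mem.2 (ht u v huv)
  · rw [Matrix.vecMul_vecMul, Matrix.adjugate_mul, Matrix.vecMul_smul, Matrix.vecMul_one]

lemma dvd_pair {R : Type*} [CommRing R] (p : Ideal R) [p.IsPrime]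
    (h : PreValuationRing (Localization.AtPrime p)) (a b : R) :
    ∃ t, t ∉ p ∧ (a ∣ t * b ∨ b ∣ t * a) := by
  have key : ∀ a b : R, ∀ c : Localization.AtPrime p,
      algebraMap R _ a * c = algebraMap R _ b → ∃ t, t ∉ p ∧ a ∣ t * b := by
    intro a b c hc
    obtain ⟨⟨r, s⟩, hs⟩ := IsLocalization.surj p.primeCompl c
    have : algebraMap R (Localization.AtPrime p) (a * r) = algebraMap R _ (b * s) := by
      simp only [map_mul] at hs ⊢
      rw [← hs, ← hc]; ring
    obtain ⟨t, ht⟩ := (IsLocalization.eq_iff_exists p.primeCompl _).1 this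
    refine ⟨t * s, (t * s).2, t * r, ?_⟩
    linear_combination -ht
  obtain ⟨c, hc | hc⟩ := h.cond' (algebraMap R _ a) (algebraMap R _ b)
  · obtain ⟨t, ht, h⟩ := key a b c hc
    exact ⟨t, ht, Or.inl h⟩
  · obtain ⟨t, ht, h⟩ := key b a c hc
    exact ⟨t, ht, Or.inr h⟩

lemma dvd_finset {R ι : Type*} [CommRing R] (p : Ideal R) [hp : p.IsPrime]
    (h : PreValuationRing (Localization.AtPrime p)) (a : ι → R) (s : Finset ι) (hs : s.Nonempty) :
    ∃ i ∈ s, ∃ t, t ∉ p ∧ ∀ j ∈ s, a i ∣ t * a j := by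
  classical
  induction hs using Finset.Nonempty.cons_induction with
  | singleton k =>
    exact ⟨k, by simp, 1, p.ne_top_iff_one.1 hp.ne_top, by simp⟩
  | cons k s hk hs ih =>
    obtain ⟨i, hi, t, ht, hj⟩ := ih
    obtain ⟨t', ht', h1 | h1⟩ := dvd_pair p h (a i) (a k)
    · refine ⟨i, by simp [hi], t * t', fun hh => (hp.mem_or_mem hh).elim ht ht', ?_⟩
      intro j hjs
      rw [Finset.mem_cons] at hjs
      rcases hjs with rfl | hjs
      · rw [mul_assoc]; exact h1.mul_left _
      · rw [mul_comm t, mul_assoc]; exact (hj j hjs).mul_left _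
    · refine ⟨k, by simp, t' * t, fun hh => (hp.mem_or_mem hh).elim ht' ht, ?_⟩
      intro j hjs
      rw [Finset.mem_cons] at hjs
      rcases hjs with rfl | hjs
      · exact (dvd_refl _).mul_left _
      · obtain ⟨x, hx⟩ := hj j hjs
        rw [mul_assoc, hx, ← mul_assoc]
        exact h1.mul_right _

lemma exists_basis {α : Type*} [PartialOrder α] [WellQuasiOrderedLE α] (S : Set α) :
    ∃ G : Set α, G.Finite ∧ G ⊆ S ∧ ∀ x ∈ S, ∃ g ∈ G, g ≤ x := by
  refine ⟨{x | Minimal (· ∈ S) x}, ?_, fun x hx => hx.1, ?_⟩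
  · exact WellQuasiOrderedLE.finite_of_isAntichain (setOfPred_minimal_antichain _)
  · intro x hx
    obtain ⟨g, hg, hm⟩ := exists_minimal_le_of_wellFoundedLT (· ∈ S) x hx
    exact ⟨g, hm, hg⟩

abbrev Mon (n m : ℕ) := Fin m ×ₗ Lex (Fin n →₀ ℕ)

variable {R : Type*} [CommRing R] {n m : ℕ}

def mk (i : Fin m) (u : Fin n →₀ ℕ) : Mon n m := toLex (i, toLex u)

def ex (a : Mon n m) : Fin n →₀ ℕ := ofLex (ofLex a).2

def ix (a : Mon n m) : Fin m := (ofLex a).1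

@[simp] lemma mk_ix_ex (a : Mon n m) : mk (ix a) (ex a) = a := rfl
@[simp] lemma ix_mk (i : Fin m) (u : Fin n →₀ ℕ) : ix (mk i u) = i := rfl
@[simp] lemma ex_mk (i : Fin m) (u : Fin n →₀ ℕ) : ex (mk i u) = u := rfl

lemma mk_lt (i j : Fin m) (u v w : Fin n →₀ ℕ) (h : mk i (u + w) < mk j (v + w)) :
    mk i u < mk j v := by
  unfold mk at *
  rw [Prod.Lex.toLex_lt_toLex] at *
  simp only [toLex_add] at h
  simpa using h

lemma mk_lt' (i j : Fin m) (u v w : Fin n →₀ ℕ) (h : mk i u < mk j v) :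
    mk i (u + w) < mk j (v + w) := by
  unfold mk at *
  rw [Prod.Lex.toLex_lt_toLex] at *
  simp only [toLex_add]
  simpa using h

abbrev Vec (R : Type*) [CommRing R] (n m : ℕ) := Fin m → MvPolynomial (Fin n) R

def co (f : Vec R n m) (a : Mon n m) : R := (f (ix a)).coeff (ex a)

def Deg (d : ℕ) (f : Vec R n m) : Prop := ∀ i, (f i).totalDegree ≤ d

def Lead (p : Ideal R) (f : Vec R n m) (a : Mon n m) : Prop :=
  co f a ∉ p ∧ ∀ b, a < b → co f b ∈ p

lemma deg_iff (d : ℕ) (f : Vec R n m) : Deg d f ↔ ∀ a, co f a ≠ 0 → (ex a).degree ≤ d := by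
  constructor
  · intro h a ha
    exact (le_totalDegree (mem_support_iff.2 ha)).trans (h _)
  · intro h i
    refine Finset.sup_le fun u hu => ?_
    exact h (mk i u) (mem_support_iff.1 hu)

lemma co_ext (f g : Vec R n m) (h : ∀ a, co f a = co g a) : f = g := by
  funext i
  ext u
  exact h (mk i u)

lemma finite_deg (d : ℕ) : {a : Mon n m | (ex a).degree ≤ d}.Finite := by
  have : ({u : Fin n →₀ ℕ | u.degree ≤ d}).Finite := by
    refine (Set.finite_Iic (Finsupp.equivFunOnFinite.symm fun _ => d)).subset ?_
    intro u hu i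
    exact (Finsupp.le_degree i u).trans hu
  refine ((Set.finite_univ (α := Fin m)).prod this |>.image fun x => mk x.1 x.2).subset ?_
  intro a ha
  exact ⟨(ix a, ex a), ⟨trivial, ha⟩, rfl⟩

lemma finite_support (f : Vec R n m) : {a | co f a ≠ 0}.Finite := by
  refine (finite_deg (Finset.univ.sup fun i => (f i).totalDegree)).subset ?_
  intro a ha
  exact (deg_iff _ f).1 (fun i => Finset.le_sup (f := fun i => (f i).totalDegree)
    (Finset.mem_univ i)) a ha

/-- Restriction to leading monomials is injective. -/
lemma injective_restrict [IsDomain R] (p : Ideal R) [p.IsPrime]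
    (hv : PreValuationRing (Localization.AtPrime p))
    (K : Submodule (MvPolynomial (Fin n) R) (Vec R n m))
    (hK : ∀ (r : R) (f : Vec R n m), r ≠ 0 → r • f ∈ K → f ∈ K)
    (d : ℕ) (f : Vec R n m) (hf : f ∈ K) (hd : Deg d f)
    (h0 : ∀ a, (∃ g ∈ K, Deg d g ∧ Lead p g a) → co f a = 0) : f = 0 := by
  classical
  by_contra hne
  have hfin := finite_support f
  have hnon : hfin.toFinset.Nonempty := by
    by_contra hh
    rw [Finset.not_nonempty_iff_eq_empty] at hh
    refine hne (co_ext _ _ fun a => ?_)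
    by_contra ha
    have : a ∈ hfin.toFinset := by simpa [co] using ha
    simp [hh] at this
  obtain ⟨a0, ha0, t, ht, hdiv⟩ := dvd_finset p hv (co f) _ hnon
  have ha0' : co f a0 ≠ 0 := by simpa using ha0
  have hdiv' : ∀ a, co f a0 ∣ t * co f a := by
    intro a
    by_cases ha : co f a = 0
    · simp [ha]
    · exact hdiv a (by simpa using ha)
  have : ∀ i, ∃ gi, C t * f i = C (co f a0) * gi := by
    intro i
    refine (C_dvd_iff_dvd_coeff _ _).2 fun u => ?_
    rw [coeff_C_mul]
    exact hdiv' (mk i u)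
  choose g hg using this
  have hgco : ∀ a, co f a0 * co g a = t * co f a := by
    intro a
    have := congrArg (coeff (ex a)) (hg (ix a))
    simp only [coeff_C_mul] at this
    exact this.symm
  have hgK : g ∈ K := by
    refine hK (co f a0) g ha0' ?_
    have : co f a0 • g = (C t : MvPolynomial (Fin n) R) • f := by
      funext i
      simp only [Pi.smul_apply, smul_eq_mul, hg i, MvPolynomial.smul_eq_C_mul]
    rw [this]
    exact K.smul_mem _ hf
  have hgd : Deg d g := by
    rw [deg_iff] at hd ⊢
    intro a ha
    refine hd a fun h => ?_
    have := hgco a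
    rw [h, mul_zero, mul_eq_zero] at this
    exact this.elim ha0' ha
  have hga0 : co g a0 ∉ p := by
    have := hgco a0
    rw [mul_comm t] at this
    rw [mul_left_cancel₀ ha0' this]
    exact ht
  have hfin2 : {a | co g a ∉ p}.Finite := (finite_support g).subset fun a ha h => ha (by
    rw [h]; exact p.zero_mem)
  obtain ⟨a, ha, hmax⟩ := hfin2.toFinset.exists_max_image id ⟨a0, by simpa using hga0⟩
  simp only [Set.Finite.mem_toFinset, Set.mem_ofPred_eq, id] at ha hmax
  have hl : Lead p g a := ⟨ha, fun b hb => by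
    by_contra hh
    exact absurd (hmax b hh) (not_le.2 hb)⟩
  have h1 := h0 a ⟨g, hgK, hgd, hl⟩
  have h2 := hgco a
  rw [h1, mul_zero, mul_eq_zero] at h2
  refine ha ?_
  rw [h2.resolve_left ha0']
  exact p.zero_mem

lemma co_shift (f : Vec R n m) (w : Fin n →₀ ℕ) (i : Fin m) (u : Fin n →₀ ℕ) :
    co ((monomial w (1 : R)) • f) (mk i (u + w)) = co f (mk i u) := by
  simp only [co, ix_mk, ex_mk, Pi.smul_apply, smul_eq_mul]
  rw [add_comm, coeff_monomial_mul, one_mul]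

lemma co_shift_zero (f : Vec R n m) (w : Fin n →₀ ℕ) (i : Fin m) (u : Fin n →₀ ℕ) (h : ¬ w ≤ u) :
    co ((monomial w (1 : R)) • f) (mk i u) = 0 := by
  simp only [co, ix_mk, ex_mk, Pi.smul_apply, smul_eq_mul]
  rw [coeff_monomial_mul', if_neg h]

lemma lead_shift (p : Ideal R) (f : Vec R n m) (w : Fin n →₀ ℕ) (i : Fin m) (u : Fin n →₀ ℕ)
    (h : Lead p f (mk i u)) : Lead p ((monomial w (1 : R)) • f) (mk i (u + w)) := by
  refine ⟨by rw [co_shift]; exact h.1, fun b hb => ?_⟩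
  rw [← mk_ix_ex b] at hb ⊢
  by_cases hw : w ≤ ex b
  · obtain ⟨v, hv⟩ := exists_add_of_le hw
    rw [hv, add_comm w v] at hb ⊢
    rw [co_shift]
    exact h.2 _ (mk_lt _ _ _ _ _ hb)
  · rw [co_shift_zero _ _ _ _ hw]
    exact p.zero_mem

lemma deg_shift (f : Vec R n m) (w : Fin n →₀ ℕ) (d : ℕ) (h : Deg d f) :
    Deg (w.degree + d) ((monomial w (1 : R)) • f) := by
  rw [deg_iff] at h ⊢
  intro a ha
  rw [← mk_ix_ex a] at ha ⊢
  by_cases hw : w ≤ ex a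
  · obtain ⟨v, hv⟩ := exists_add_of_le hw
    rw [hv, add_comm w v, co_shift] at ha
    have := h _ ha
    rw [ex_mk] at this ⊢
    rw [hv, map_add]
    omega
  · exact absurd (co_shift_zero _ _ _ _ hw) ha

/-- Ultraproduct of ideals. -/
def ulim {X : Type*} (U : Ultrafilter X) (q : X → Ideal R) : Ideal R where
  carrier := {a | ∀ᶠ x in U, a ∈ q x}
  add_mem' := fun ha hb => by
    filter_upwards [ha, hb] with x h1 h2 using (q x).add_mem h1 h2
  zero_mem' := Filter.Eventually.of_forall fun x => (q x).zero_mem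
  smul_mem' := fun c a ha => by
    filter_upwards [ha] with x h1 using (q x).mul_mem_left c h1

lemma mem_ulim {X : Type*} (U : Ultrafilter X) (q : X → Ideal R) (a : R) :
    a ∈ ulim U q ↔ ∀ᶠ x in U, a ∈ q x := Iff.rfl

lemma ulim_prime {X : Type*} (U : Ultrafilter X) (q : X → Ideal R) (hq : ∀ x, (q x).IsPrime) :
    (ulim U q).IsPrime := by
  refine ⟨?_, ?_⟩
  · rw [Ideal.ne_top_iff_one, mem_ulim]
    intro h
    obtain ⟨x, hx⟩ := h.exists
    exact (q x).ne_top_iff_one.1 (hq x).ne_top hx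
  · intro a b h
    rw [mem_ulim] at *
    rw [mem_ulim, ← Ultrafilter.eventually_or]
    filter_upwards [h] with x hx using (hq x).mem_or_mem hx

theorem saturated_fg (hR : IsPruferDomain R)
    (K : Submodule (MvPolynomial (Fin n) R) (Vec R n m))
    (hK : ∀ (r : R) (f : Vec R n m), r ≠ 0 → r • f ∈ K → f ∈ K) : K.FG := by
  classical
  obtain ⟨hdom, hval⟩ := hR
  by_contra hfg
  let S : Finset K → Submodule (MvPolynomial (Fin n) R) (Vec R n m) :=
    fun G => Submodule.span _ ((↑) '' (G : Set K))
  have hSK : ∀ G, S G ≤ K := fun G => by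
    refine Submodule.span_le.2 ?_
    rintro _ ⟨x, -, rfl⟩
    exact x.2
  have step : ∀ G : Finset K, ∃ f ∈ K, ∃ q : Ideal R, q.IsPrime ∧ ∀ s : R, s ∉ q → s • f ∉ S G := by
    intro G
    have : ¬ K ≤ S G := fun h => hfg ⟨G.image (↑), by
      rw [Finset.coe_image]; exact le_antisymm (hSK G) h⟩
    obtain ⟨f, hf, hfS⟩ := SetLike.not_le_iff_exists.1 this
    let J : Ideal R :=
      { carrier := {r | r • f ∈ S G}
        add_mem' := fun {a b} ha hb => by
          change (a + b) • f ∈ S G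
          rw [add_smul]; exact (S G).add_mem ha hb
        zero_mem' := by
          change (0 : R) • f ∈ S G
          rw [zero_smul]; exact (S G).zero_mem
        smul_mem' := fun c a ha => by
          change (c * a) • f ∈ S G
          rw [mul_smul, ← algebraMap_smul (MvPolynomial (Fin n) R) c]
          exact (S G).smul_mem _ ha }
    have hJ : J ≠ ⊤ := by
      rw [Ideal.ne_top_iff_one]
      intro h
      apply hfS
      have h' : (1 : R) • f ∈ S G := h
      rwa [one_smul] at h'
    obtain ⟨q, hq, hJq⟩ := J.exists_le_maximal hJ
    exact ⟨f, hf, q, hq.isPrime, fun s hs h => hs (hJq h)⟩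
  choose F hF q hq hqs using step
  let U : Ultrafilter (Finset K) := Ultrafilter.of atTop
  have hU : (U : Filter (Finset K)) ≤ atTop := Ultrafilter.of_le _
  let p := ulim U q
  have hp : p.IsPrime := ulim_prime U q hq
  -- finite basis
  let Q : Fin m → Set ((Fin n →₀ ℕ) × ℕ) :=
    fun i => {x | ∃ f ∈ K, Deg (x.1.degree + x.2) f ∧ Lead p f (mk i x.1)}
  choose B hBfin hBQ hB using fun i => exists_basis (Q i)
  have hw : ∀ i, ∀ x, ∃ f : Vec R n m, x ∈ B i →
      f ∈ K ∧ Deg (x.1.degree + x.2) f ∧ Lead p f (mk i x.1) := by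
    intro i x
    by_cases hx : x ∈ B i
    · obtain ⟨f, h⟩ := hBQ i hx
      exact ⟨f, fun _ => h⟩
    · exact ⟨0, fun h => absurd h hx⟩
  choose W hW using hw
  have hev : ∀ᶠ G in U, ∀ i, ∀ x ∈ B i, W i x ∈ S G ∧ Lead (q G) (W i x) (mk i x.1) := by
    rw [Filter.eventually_all]
    intro i
    rw [Filter.eventually_all_finite (hBfin i)]
    intro x hx
    obtain ⟨h1, h2, h3⟩ := hW i x hx
    have e1 : ∀ᶠ G in U, W i x ∈ S G := by
      have : ∀ᶠ G in (atTop : Filter (Finset K)), {(⟨W i x, h1⟩ : K)} ≤ G := eventually_ge_atTop _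
      filter_upwards [hU this] with G hG
      exact Submodule.subset_span ⟨⟨W i x, h1⟩, hG (Finset.mem_singleton_self _), rfl⟩
    have e2 : ∀ᶠ G in U, co (W i x) (mk i x.1) ∉ q G := by
      rw [Ultrafilter.eventually_not]
      exact h3.1
    have e3 : ∀ᶠ G in U, ∀ b ∈ {b | co (W i x) b ≠ 0}, mk i x.1 < b → co (W i x) b ∈ q G := by
      rw [Filter.eventually_all_finite (finite_support _)]
      intro b _
      by_cases hb : mk i x.1 < b
      · have := h3.2 b hb
        rw [mem_ulim] at this
        filter_upwards [this] with G hG _ using hG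
      · exact Filter.Eventually.of_forall fun _ h => absurd h hb
    filter_upwards [e1, e2, e3] with G g1 g2 g3
    refine ⟨g1, g2, fun b hb => ?_⟩
    by_cases h0 : co (W i x) b = 0
    · rw [h0]; exact (q G).zero_mem
    · exact g3 b h0 hb
  obtain ⟨G, hG⟩ := hev.exists
  obtain ⟨d, hd⟩ : ∃ d, Deg d (F G) := ⟨Finset.univ.sup fun i => (F G i).totalDegree,
    fun i => Finset.le_sup (f := fun i => (F G i).totalDegree) (Finset.mem_univ i)⟩
  let T : Set (Mon n m) := {a | ∃ g ∈ K, Deg d g ∧ Lead p g a}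
  have hTfin : T.Finite := by
    refine (finite_deg d).subset ?_
    rintro a ⟨g, -, hg, hl⟩
    exact (deg_iff _ _).1 hg a fun h => hl.1 (by rw [h]; exact p.zero_mem)
  have hwit : ∀ a : T, ∃ g ∈ S G, Deg d g ∧ Lead (q G) g a := by
    rintro ⟨a, g, hgK, hg, hl⟩
    have hda : (ex a).degree ≤ d :=
      (deg_iff _ _).1 hg a fun h => hl.1 (by rw [h]; exact p.zero_mem)
    obtain ⟨⟨u, e⟩, hu, hle⟩ := hB (ix a) (ex a, d - (ex a).degree)
      ⟨g, hgK, by simpa [Nat.add_sub_cancel' hda] using hg, hl⟩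
    obtain ⟨h1, h2⟩ := hG (ix a) _ hu
    have h3 := (hW (ix a) _ hu).2.1
    obtain ⟨hle1, hle2⟩ := Prod.mk_le_mk.1 hle
    obtain ⟨w, hw⟩ := exists_add_of_le hle1
    refine ⟨(monomial w (1 : R)) • W (ix a) (u, e), (S G).smul_mem _ h1, ?_, ?_⟩
    · have h4 := deg_shift _ w _ h3
      intro i
      refine (h4 i).trans ?_
      have : (ex a).degree = u.degree + w.degree := by rw [hw, map_add]
      simp only at *
      omega
    · have := lead_shift _ _ w _ _ h2
      simp only [← hw] at this
      exact this
  choose g hgS hgd hgl using hwit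
  have : Fintype T := hTfin.fintype
  have := hq G
  obtain ⟨s, hs, c, hc⟩ := cramer (q G) (Matrix.of fun a b : T => co (g a) (b : Mon n m))
    (fun a => (hgl a).1) (fun a b hab => (hgl a).2 b hab) (fun b => co (F G) (b : Mon n m))
  have hcS : ∑ a, c a • g a ∈ S G := by
    refine (S G).sum_mem fun a _ => ?_
    rw [← algebraMap_smul (MvPolynomial (Fin n) R) (c a)]
    exact (S G).smul_mem _ (hgS a)
  have hco : ∀ b, co (s • F G - ∑ a, c a • g a) b = s * co (F G) b - ∑ a, c a * co (g a) b := by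
    intro b
    simp [co, coeff_sum, Finset.sum_apply]
  have hzero : s • F G - ∑ a, c a • g a = 0 := by
    refine injective_restrict p (hval p) K hK d _ ?_ ?_ ?_
    · refine K.sub_mem ?_ (hSK G hcS)
      rw [← algebraMap_smul (MvPolynomial (Fin n) R) s]
      exact K.smul_mem _ (hF G)
    · rw [deg_iff]
      intro b hb
      by_contra hbd
      apply hb
      have z : ∀ f : Vec R n m, Deg d f → co f b = 0 := fun f hf => by
        by_contra h
        exact hbd ((deg_iff _ _).1 hf b h)
      rw [hco, z _ hd]
      simp [fun a => z _ (hgd a)]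
    · intro b hb
      have := congrFun hc ⟨b, hb⟩
      rw [hco]
      simp only [Matrix.vecMul, dotProduct, Matrix.of_apply, Pi.smul_apply, smul_eq_mul] at this
      rw [this, sub_self]
  refine hqs G s hs ?_
  rw [sub_eq_zero.1 hzero]
  exact hcS

theorem syz_fg (hR : IsPruferDomain R) (b : Fin m → MvPolynomial (Fin n) R) :
    (LinearMap.ker (Fintype.linearCombination (MvPolynomial (Fin n) R) b)).FG := by
  have := hR.1
  refine saturated_fg hR _ ?_
  intro r f hr h
  rw [LinearMap.mem_ker] at h ⊢
  rw [← algebraMap_smul (MvPolynomial (Fin n) R) r, map_smul, smul_eq_zero] at h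
  refine h.resolve_left ?_
  rw [MvPolynomial.algebraMap_eq, C_eq_zero]
  exact hr

end PruferCoh

/-- a finitely presented algebra over a Prüfer domain is a coherent ring:
every finitely generated ideal is finitely presented as a module. -/
theorem stmt_5 {R A : Type*} [CommRing R] [CommRing A] [Algebra R A]
    (hR : IsPruferDomain R) (hA : Algebra.FinitePresentation R A) :
    ∀ I : Ideal A, I.FG → Module.FinitePresentation A I := by
  classical
  intro I hI
  obtain ⟨n, φ, hφ, hker⟩ := hA.out
  obtain ⟨k, a, ha⟩ := Submodule.fg_iff_exists_fin_generating_family.1 hI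
  obtain ⟨l, j, hj⟩ := Submodule.fg_iff_exists_fin_generating_family.1 hker
  choose b hb using fun i => hφ (a i)
  have haI : ∀ i, a i ∈ I := fun i => ha ▸ Submodule.subset_span ⟨i, rfl⟩
  let L : (Fin k → A) →ₗ[A] I := Fintype.linearCombination A (fun i => (⟨a i, haI i⟩ : I))
  have hLv : ∀ x, (L x : A) = ∑ i, x i * a i := by
    intro x
    simp [L, Fintype.linearCombination_apply]
  have hLs : Function.Surjective L := by
    rintro ⟨y, hy⟩
    rw [← ha] at hy
    obtain ⟨c, hc⟩ := (Submodule.mem_span_range_iff_exists_fun A).1 hy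
    exact ⟨c, Subtype.ext (by rw [hLv]; simpa using hc)⟩
  refine Module.finitePresentation_of_surjective L hLs ?_
  obtain ⟨Z, hZ⟩ := PruferCoh.syz_fg hR (Fin.append b j)
  let π : (Fin (k + l) → MvPolynomial (Fin n) R) → (Fin k → A) := fun z i => φ (z (Fin.castAdd l i))
  have hmemZ : ∀ z, z ∈ LinearMap.ker (Fintype.linearCombination (MvPolynomial (Fin n) R)
      (Fin.append b j)) ↔
      ∑ i, z (Fin.castAdd l i) * b i + ∑ i, z (Fin.natAdd k i) * j i = 0 := by
    intro z
    simp [LinearMap.mem_ker, Fintype.linearCombination_apply, Fin.sum_univ_add]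
  have hj0 : ∀ i, φ (j i) = 0 := fun i => by
    have : j i ∈ RingHom.ker φ.toRingHom := hj ▸ Submodule.subset_span ⟨i, rfl⟩
    exact this
  refine ⟨Z.image π, le_antisymm ?_ ?_⟩
  · rw [Submodule.span_le]
    intro x hx
    rw [Finset.coe_image] at hx
    obtain ⟨z, hz, rfl⟩ := hx
    have hz' := (hmemZ z).1 (hZ ▸ Submodule.subset_span hz)
    have := congrArg φ hz'
    simp only [map_add, map_sum, map_mul, hj0, hb, mul_zero, Finset.sum_const_zero, add_zero,
      map_zero] at this
    exact Subtype.ext (by rw [hLv]; exact this)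
  · intro x hx
    have hx' : ∑ i, x i * a i = 0 := by
      rw [← hLv, LinearMap.mem_ker.1 hx]; rfl
    choose y hy using fun i => hφ (x i)
    have hk : ∑ i, y i * b i ∈ RingHom.ker φ.toRingHom := by
      change φ _ = 0
      simp only [map_sum, map_mul, hy, hb, hx']
    rw [← hj] at hk
    obtain ⟨c, hc⟩ := (Submodule.mem_span_range_iff_exists_fun _).1 hk
    have hz : Fin.append y (-c) ∈ Submodule.span (MvPolynomial (Fin n) R)
        (Z : Set (Fin (k + l) → MvPolynomial (Fin n) R)) := by
      rw [hZ, hmemZ]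
      simp only [smul_eq_mul] at hc
      simp [← hc]
    have hπ : ∀ z ∈ Submodule.span (MvPolynomial (Fin n) R)
        (Z : Set (Fin (k + l) → MvPolynomial (Fin n) R)),
        π z ∈ Submodule.span A ((Z.image π : Finset _) : Set (Fin k → A)) := by
      intro z hz
      induction hz using Submodule.span_induction with
      | mem z hz => exact Submodule.subset_span (by simpa using ⟨z, hz, rfl⟩)
      | zero =>
        convert Submodule.zero_mem _
        funext i
        simp [π]
      | add z w _ _ h1 h2 =>
        convert Submodule.add_mem _ h1 h2
        funext i
        simp [π]
      | smul r z _ h1 =>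
        convert Submodule.smul_mem _ (φ r) h1
        funext i
        simp [π]
    have := hπ _ hz
    convert this
    funext i
    simp [π, hy]
end
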